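/- Let a, b, Δt > 0 be such that 1, a·Δt, b·Δt are linearly independent over ℚ. Then for all amplitudes A, B ∈ ℝ, all phases φ₁, φ₂ ∈ ℝ, and every continuous g : ℝ → ℝ, the sample averages (1/N) ∑_{n=0}^{N-1} g( A·sin(2π a n Δt + φ₁) + B·sin(2π b n Δt + φ₂) ) converge, as N → ∞, to ∫_0^1 ∫_0^1 g( A·sin(2π u) + B·sin(2π v) ) du dv. In particular the limiting sample statistics do not depend on the phases φ₁, φ₂; since the samples of the sinc reconstruction of the undersampled signal at any shift of the sampling comb differ from samples of the original only by constant phase offsets in each component, a sum of sine waves with incommensurate frequencies has sampling stationarity that is NOT broken by undersampling and reconstruction, so aliasing cannot be detected by this method. -/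

import Mathlib

open Filter Real

open MeasureTheory Submodule

/-- **Weyl's criterion**: the sample averages along a sequence converge to the integral for every
continuous function as soon as they do so for a family whose linear span is dense. -/
lemma tendsto_average_of_span_dense {X : Type*} [TopologicalSpace X] [CompactSpace X]
    [MeasurableSpace X] [BorelSpace X] (μ : Measure X) [IsProbabilityMeasure μ] (x : ℕ → X)
    (S : Set C(X, ℂ)) (hS : (span ℂ S).topologicalClosure = ⊤)
    (h : ∀ f ∈ S, Tendsto (fun N : ℕ => (N : ℂ)⁻¹ * ∑ n ∈ Finset.range N, f (x n)) atTop
      (nhds (∫ y, f y ∂μ))) (f : C(X, ℂ)) :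
    Tendsto (fun N : ℕ => (N : ℂ)⁻¹ * ∑ n ∈ Finset.range N, f (x n)) atTop
      (nhds (∫ y, f y ∂μ)) := by
  have hint (f : C(X, ℂ)) : Integrable f μ :=
    f.continuous.integrable_of_hasCompactSupport (HasCompactSupport.of_compactSpace f)
  have hspan : ∀ f ∈ span ℂ S, Tendsto
      (fun N : ℕ => (N : ℂ)⁻¹ * ∑ n ∈ Finset.range N, f (x n)) atTop (nhds (∫ y, f y ∂μ)) := by
    intro f hf
    induction hf using span_induction with
    | mem f hf => exact h f hf
    | zero => simp
    | add f g _ _ hf hg =>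
      have := hf.add hg
      rw [← integral_add (hint f) (hint g)] at this
      simpa [Finset.sum_add_distrib, mul_add] using this
    | smul c f _ hf =>
      have := hf.const_mul c
      rw [← integral_const_mul] at this
      refine this.congr fun N => ?_
      simp only [ContinuousMap.smul_apply, smul_eq_mul, ← Finset.mul_sum]
      ring
  have hf : f ∈ (span ℂ S).topologicalClosure := hS ▸ mem_top
  rw [Metric.tendsto_atTop]
  intro ε hε
  obtain ⟨g, hg, hfg⟩ := Metric.mem_closure_iff.1 hf (ε / 3) (by positivity)
  obtain ⟨N₀, hN₀⟩ := Metric.tendsto_atTop.1 (hspan g hg) (ε / 3) (by positivity)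
  refine ⟨N₀, fun N hN => ?_⟩
  have hpt (y : X) : ‖f y - g y‖ ≤ dist f g := by
    rw [← dist_eq_norm]; exact ContinuousMap.dist_apply_le_dist y
  have h_avg : dist ((N : ℂ)⁻¹ * ∑ n ∈ Finset.range N, f (x n))
      ((N : ℂ)⁻¹ * ∑ n ∈ Finset.range N, g (x n)) ≤ dist f g := by
    rw [dist_eq_norm, ← mul_sub, ← Finset.sum_sub_distrib, norm_mul, norm_inv, Complex.norm_natCast]
    have hsum : ‖∑ n ∈ Finset.range N, (f (x n) - g (x n))‖ ≤ N * dist f g := by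
      simpa using norm_sum_le_of_le (Finset.range N) fun n _ => hpt (x n)
    rcases N.eq_zero_or_pos with rfl | hpos
    · simp
    · rwa [inv_mul_le_iff₀ (by positivity)]
  have h_integral : dist (∫ y, g y ∂μ) (∫ y, f y ∂μ) ≤ dist f g := by
    rw [dist_comm, dist_eq_norm, ← integral_sub (hint f) (hint g)]
    simpa using norm_integral_le_of_norm_le_const (μ := μ) (ae_of_all _ hpt)
  calc dist ((N : ℂ)⁻¹ * ∑ n ∈ Finset.range N, f (x n)) (∫ y, f y ∂μ)
      ≤ _ := dist_triangle4 _ _ _ _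
    _ < ε := by linarith [hN₀ N hN]

/-- Averages of the powers of a number `z ≠ 1` on the unit circle tend to zero. -/
lemma tendsto_average_pow_zero {z : ℂ} (hz : ‖z‖ = 1) (hz1 : z ≠ 1) :
    Tendsto (fun N : ℕ => (N : ℂ)⁻¹ * ∑ n ∈ Finset.range N, z ^ n) atTop (nhds 0) := by
  refine squeeze_zero_norm (a := fun N : ℕ => (N : ℝ)⁻¹ * (2 / ‖z - 1‖)) (fun N => ?_) ?_
  · rw [geom_sum_eq hz1, norm_mul, norm_inv, Complex.norm_natCast, norm_div]
    gcongr
    refine (norm_sub_le _ _).trans ?_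
    norm_num [hz]
  · simpa using (tendsto_inv_atTop_nhds_zero_nat (𝕜 := ℝ)).mul_const (2 / ‖z - 1‖)

lemma integral_fourier_Ioc {k : ℤ} (hk : k ≠ 0) :
    ∫ u in Set.Ioc (0 : ℝ) 1, fourier k (u : UnitAddCircle) = 0 := by
  rw [← intervalIntegral.integral_of_le zero_le_one]
  have hc : 2 * π * Complex.I * k ≠ 0 := by simp [hk, pi_ne_zero]
  have : ∀ u : ℝ, fourier k (u : UnitAddCircle) = Complex.exp (2 * π * Complex.I * k * u) := by
    intro u
    rw [fourier_coe_apply]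
    simp
  simp_rw [this]
  rw [integral_exp_mul_complex hc]
  have h1 : Complex.exp (2 * π * Complex.I * k) = 1 :=
    Complex.exp_eq_one_iff.2 ⟨k, by ring⟩
  simp [h1]

/-- The projection of the plane onto the two-dimensional torus. -/
def toTorus (p : ℝ × ℝ) : UnitAddTorus (Fin 2) := ![(p.1 : UnitAddCircle), (p.2 : UnitAddCircle)]

lemma continuous_toTorus : Continuous toTorus := by
  refine continuous_pi fun i => ?_
  fin_cases i
  · exact (AddCircle.continuous_mk' 1).comp continuous_fst
  · exact (AddCircle.continuous_mk' 1).comp continuous_snd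

/-- Lebesgue measure on the unit square. -/
noncomputable def unitSquareMeasure : Measure (ℝ × ℝ) :=
  (volume.restrict (Set.Ioc 0 1)).prod (volume.restrict (Set.Ioc 0 1))

instance : IsProbabilityMeasure unitSquareMeasure := by
  have : IsProbabilityMeasure (volume.restrict (Set.Ioc (0 : ℝ) 1)) := ⟨by simp⟩
  unfold unitSquareMeasure
  infer_instance

lemma mFourier_toTorus (k : Fin 2 → ℤ) (p : ℝ × ℝ) :
    UnitAddTorus.mFourier k (toTorus p) =
      fourier (k 0) (p.1 : UnitAddCircle) * fourier (k 1) (p.2 : UnitAddCircle) := by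
  simp [UnitAddTorus.mFourier, toTorus, Fin.prod_univ_two]

lemma integral_mFourier_toTorus {k : Fin 2 → ℤ} (hk : k ≠ 0) :
    ∫ p, UnitAddTorus.mFourier k (toTorus p) ∂unitSquareMeasure = 0 := by
  simp_rw [mFourier_toTorus]
  rw [unitSquareMeasure, integral_prod_mul (fun u : ℝ => fourier (k 0) (u : UnitAddCircle))
    (fun v : ℝ => fourier (k 1) (v : UnitAddCircle))]
  by_cases h0 : k 0 = 0
  · have h1 : k 1 ≠ 0 := fun h1 => hk (by ext i; fin_cases i <;> assumption)
    rw [integral_fourier_Ioc h1, mul_zero]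
  · rw [integral_fourier_Ioc h0, zero_mul]

/-- **Weyl's equidistribution theorem** on the two-dimensional torus. -/
lemma tendsto_average_toTorus {α β : ℝ} (hindep : LinearIndependent ℚ ![(1 : ℝ), α, β])
    (s t : ℝ) (f : C(UnitAddTorus (Fin 2), ℂ)) :
    Tendsto (fun N : ℕ => (N : ℂ)⁻¹ *
        ∑ n ∈ Finset.range N, f (toTorus (n * α + s, n * β + t))) atTop
      (nhds (∫ p, f (toTorus p) ∂unitSquareMeasure)) := by
  have hmap (f : C(UnitAddTorus (Fin 2), ℂ)) :
      ∫ y, f y ∂(unitSquareMeasure.map toTorus) = ∫ p, f (toTorus p) ∂unitSquareMeasure :=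
    integral_map continuous_toTorus.aemeasurable f.continuous.aestronglyMeasurable
  have : IsProbabilityMeasure (unitSquareMeasure.map toTorus) :=
    Measure.isProbabilityMeasure_map continuous_toTorus.aemeasurable
  rw [← hmap]
  refine tendsto_average_of_span_dense _ (fun n : ℕ => toTorus (n * α + s, n * β + t)) _
    UnitAddTorus.span_mFourier_closure_eq_top ?_ f
  rintro _ ⟨k, rfl⟩
  rw [hmap]
  rcases eq_or_ne k 0 with rfl | hk
  · simp only [UnitAddTorus.mFourier_zero, ContinuousMap.one_apply, integral_const, probReal_univ,
      one_smul, Finset.sum_const, Finset.card_range, nsmul_eq_mul, mul_one]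
    refine tendsto_const_nhds.congr' ?_
    filter_upwards [eventually_ne_atTop 0] with N hN
    rw [inv_mul_cancel₀ (Nat.cast_ne_zero.2 hN)]
  · rw [integral_mFourier_toTorus hk]
    set z : ℂ := Complex.exp ((2 * π * (k 0 * α + k 1 * β) : ℝ) * Complex.I) with hz
    set c : ℂ := Complex.exp ((2 * π * (k 0 * s + k 1 * t) : ℝ) * Complex.I) with hc
    have hz1 : z ≠ 1 := by
      intro h
      obtain ⟨m, hm⟩ := Complex.exp_eq_one_iff.1 h
      have hm' : 2 * π * (k 0 * α + k 1 * β) = 2 * π * m := by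
        have h2 : ((2 * π * (k 0 * α + k 1 * β) : ℝ) : ℂ) = ((2 * π * m : ℝ) : ℂ) := by
          apply mul_right_cancel₀ Complex.I_ne_zero
          rw [hm]
          push_cast
          ring
        exact_mod_cast h2
      have hm'' : k 0 * α + k 1 * β = m := mul_left_cancel₀ (by positivity) hm'
      have hrel := Fintype.linearIndependent_iff.1 hindep ![-(m : ℚ), k 0, k 1] (by
        simp only [Fin.sum_univ_three, Rat.smul_def]
        simp
        linear_combination hm'')
      refine hk (funext fun i => ?_)
      fin_cases i
      · simpa using hrel 1
      · simpa using hrel 2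
    have hterm (n : ℕ) : UnitAddTorus.mFourier k (toTorus (n * α + s, n * β + t)) = c * z ^ n := by
      rw [mFourier_toTorus, fourier_coe_apply, fourier_coe_apply, hz, hc, ← Complex.exp_nat_mul,
        ← Complex.exp_add, ← Complex.exp_add]
      congr 1
      push_cast
      ring
    simp_rw [hterm, ← Finset.mul_sum, mul_left_comm _ c]
    simpa only [mul_zero] using
      (tendsto_average_pow_zero (Complex.norm_exp_ofReal_mul_I _) hz1).const_mul c

lemma im_fourier_one_coe (u : ℝ) :
    (fourier 1 (u : UnitAddCircle) : ℂ).im = Real.sin (2 * π * u) := by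
  rw [fourier_coe_apply, ← Complex.exp_ofReal_mul_I_im]
  congr 2
  push_cast
  ring

/-- For a sum of two sine waves whose frequencies are incommensurate with each other and
with the sampling rate (`1`, `a·Δt`, `b·Δt` linearly independent over `ℚ`), the sample
averages of any continuous test function converge to a double average over the two
phases, independently of the phase offsets `φ₁`, `φ₂`.  Hence such a signal has sampling
stationarity that is not broken by undersampling and reconstruction (whose samples at any
shift differ from samples of the original only by constant phase offsets in each
component), and aliasing cannot be detected by this method. -/
theorem incommensurate_sum_sample_statistics
    (a b Δt : ℝ) (ha : 0 < a) (hb : 0 < b) (hΔt : 0 < Δt)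
    (hindep : LinearIndependent ℚ ![(1 : ℝ), a * Δt, b * Δt]) :
    ∀ A B φ₁ φ₂ : ℝ, ∀ g : ℝ → ℝ, Continuous g →
      Tendsto
        (fun N : ℕ => (1 / (N : ℝ)) * ∑ n ∈ Finset.range N,
          g (A * Real.sin (2 * π * a * n * Δt + φ₁)
             + B * Real.sin (2 * π * b * n * Δt + φ₂)))
        atTop
        (nhds (∫ u in (0:ℝ)..1, ∫ v in (0:ℝ)..1,
          g (A * Real.sin (2 * π * u) + B * Real.sin (2 * π * v)))) := by
  intro A B φ₁ φ₂ g hg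
  let F : C(UnitAddTorus (Fin 2), ℂ) :=
    ⟨fun x => (g (A * (fourier 1 (x 0) : ℂ).im + B * (fourier 1 (x 1) : ℂ).im) : ℝ), by fun_prop⟩
  have hF (u v : ℝ) : F (toTorus (u, v)) =
      (g (A * Real.sin (2 * π * u) + B * Real.sin (2 * π * v)) : ℝ) := by
    simp only [← im_fourier_one_coe]
    rfl
  have key := tendsto_average_toTorus hindep (φ₁ / (2 * π)) (φ₂ / (2 * π)) F
  have hlim : ∫ p, F (toTorus p) ∂unitSquareMeasure =
      ((∫ u in (0:ℝ)..1, ∫ v in (0:ℝ)..1,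
        g (A * Real.sin (2 * π * u) + B * Real.sin (2 * π * v)) : ℝ) : ℂ) := by
    have hint : Integrable (fun p => F (toTorus p)) unitSquareMeasure :=
      Integrable.of_bound (F.continuous.comp continuous_toTorus).aestronglyMeasurable ‖F‖
        (ae_of_all _ fun p => F.norm_coe_le_norm _)
    rw [unitSquareMeasure] at hint ⊢
    rw [integral_prod _ hint]
    simp_rw [hF, integral_complex_ofReal, intervalIntegral.integral_of_le zero_le_one]
  rw [hlim] at key
  have hre := (Complex.continuous_re.tendsto _).comp key
  rw [Complex.ofReal_re] at hre
  refine hre.congr fun N => ?_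
  have hterm (n : ℕ) : F (toTorus (n * (a * Δt) + φ₁ / (2 * π), n * (b * Δt) + φ₂ / (2 * π))) =
      (g (A * Real.sin (2 * π * a * n * Δt + φ₁) + B * Real.sin (2 * π * b * n * Δt + φ₂)) : ℝ) := by
    have hphase (c φ : ℝ) : 2 * π * (n * (c * Δt) + φ / (2 * π)) = 2 * π * c * n * Δt + φ := by
      field_simp
    rw [hF, hphase, hphase]
  simp only [Function.comp_apply, hterm]
  rw [← Complex.ofReal_sum, ← Complex.ofReal_natCast, ← Complex.ofReal_inv, ← Complex.ofReal_mul,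
    Complex.ofReal_re, one_div]
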